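/- Let K be a field containing a primitive n-th root of unity ε and a, b ∈ K*. The symbol algebra (a,b;K,ε) is split (i.e., isomorphic to the n×n matrix algebra over K) if and only if b is a norm from the extension K(a^{1/n})/K. -/

import Mathlib

set_option synthInstance.maxHeartbeats 1000000
set_option maxHeartbeats 1000000

open scoped TensorProduct

/-- The defining relations of the symbol algebra `(a,b;K,ε)`: generators `u = ι 0`, `v = ι 1`
with `uⁿ = a`, `vⁿ = b`, `uv = ε·vu`. -/
def SymbolRel (K : Type) [Field K] (n : ℕ) (ε a b : K) :
    FreeAlgebra K (Fin 2) → FreeAlgebra K (Fin 2) → Prop := fun p q =>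
  (p = (FreeAlgebra.ι K (0 : Fin 2)) ^ n ∧ q = algebraMap K _ a) ∨
  (p = (FreeAlgebra.ι K (1 : Fin 2)) ^ n ∧ q = algebraMap K _ b) ∨
  (p = FreeAlgebra.ι K (0 : Fin 2) * FreeAlgebra.ι K (1 : Fin 2) ∧
    q = algebraMap K _ ε * (FreeAlgebra.ι K (1 : Fin 2) * FreeAlgebra.ι K (0 : Fin 2)))

/-- The symbol algebra `(a,b;K,ε)`. -/
noncomputable def SymbolAlgebra (K : Type) [Field K] (n : ℕ) (ε a b : K) : Type :=
  RingQuot (SymbolRel K n ε a b)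

noncomputable instance (K : Type) [Field K] (n : ℕ) (ε a b : K) :
    Ring (SymbolAlgebra K n ε a b) := by unfold SymbolAlgebra; infer_instance

noncomputable instance (K : Type) [Field K] (n : ℕ) (ε a b : K) :
    Algebra K (SymbolAlgebra K n ε a b) := by unfold SymbolAlgebra; infer_instance

section

open Polynomial

/-- The twisted product of `f` over powers of `ζ`; modulo `X ^ n - C a` it represents the
norm of the class of `f` from `K[X] / (X ^ n - C a)` to `K`. -/
noncomputable def twistedProd {K : Type*} [Field K] (ζ : K) (f : K[X]) (k : ℕ) : K[X] :=
  ∏ i ∈ Finset.range k, f.comp (C (ζ ^ i) * X)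

section Field

variable {K L : Type*} [Field K] [Field L] [Algebra K L] {n : ℕ} {ζ a : K} {α : L}

theorem adjoin_nthRoot_eq_top (hn : 0 < n) (hζ : IsPrimitiveRoot ζ n)
    (hα : α ^ n = algebraMap K L a) (hgen : IntermediateField.adjoin K {α} = ⊤)
    {x : L} (hx : x ^ n = algebraMap K L a) : IntermediateField.adjoin K {x} = ⊤ := by
  have hζL : IsPrimitiveRoot (algebraMap K L ζ) n :=
    hζ.map_of_injective (algebraMap K L).injective
  have hmem : α ∈ nthRoots n (algebraMap K L a) := (mem_nthRoots hn).2 hα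
  rw [hζL.nthRoots_eq hx] at hmem
  obtain ⟨i, -, rfl⟩ := Multiset.mem_map.1 hmem
  rw [eq_top_iff, ← hgen, IntermediateField.adjoin_simple_le_iff]
  rw [← map_pow]
  exact mul_mem (IntermediateField.algebraMap_mem _ _)
    (IntermediateField.mem_adjoin_simple_self K x)

theorem isGalois_of_adjoin_nthRoot (hn : 0 < n) (hζ : IsPrimitiveRoot ζ n) (ha : a ≠ 0)
    [FiniteDimensional K L]
    (hα : α ^ n = algebraMap K L a) (hgen : IntermediateField.adjoin K {α} = ⊤) :
    IsGalois K L := by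
  have : NeZero n := ⟨hn.ne'⟩
  have hn' : (n : K) ≠ 0 := hζ.neZero'.out
  have : IsSplittingField K L (X ^ n - C a) := by
    constructor
    · rw [Polynomial.map_sub, Polynomial.map_pow, Polynomial.map_C, Polynomial.map_X]
      exact X_pow_sub_C_splits_of_isPrimitiveRoot
        (hζ.map_of_injective (algebraMap K L).injective) hα
    · rw [eq_top_iff, ← IntermediateField.top_toSubalgebra, ← hgen,
        IntermediateField.adjoin_simple_toSubalgebra_of_isAlgebraic (IsAlgebraic.of_finite K α)]
      apply Algebra.adjoin_mono
      rw [Set.singleton_subset_iff, mem_rootSet_of_ne (X_pow_sub_C_ne_zero hn a),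
        aeval_def, eval₂_sub, eval₂_X_pow, eval₂_C, hα, sub_self]
  exact IsGalois.of_separable_splitting_field (p := X ^ n - C a) (separable_X_pow_sub_C a hn' ha)

open scoped Classical in
theorem algebraMap_norm_aeval_eq_prod_conjugates [FiniteDimensional K L] [IsGalois K L] {x : L}
    (hgen : IntermediateField.adjoin K {x} = ⊤) (hn : 0 < n) (hx : x ^ n = algebraMap K L a)
    (f : K[X]) :
    algebraMap K L (Algebra.norm K (aeval x f)) =
      ∏ y ∈ (nthRoots n (algebraMap K L a)).toFinset with minpoly K y = minpoly K x,
        aeval y f := by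
  rw [Algebra.norm_eq_prod_automorphisms]
  refine Finset.prod_bij (fun σ _ => σ x) ?_ ?_ ?_ ?_
  · intro σ _
    simp only [Finset.mem_filter, Multiset.mem_toFinset, mem_nthRoots hn]
    exact ⟨by rw [← map_pow, hx, AlgEquiv.commutes], minpoly.algEquiv_eq σ x⟩
  · intro σ _ τ _ h
    have := IntermediateField.algHom_ext_of_eq_adjoin K (S := ⊤) hgen.symm
      (φ₁ := (σ : L →ₐ[K] L).comp (IntermediateField.val ⊤))
      (φ₂ := (τ : L →ₐ[K] L).comp (IntermediateField.val ⊤)) (by simpa using h)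
    ext y
    exact DFunLike.congr_fun this ⟨y, trivial⟩
  · intro y hy
    obtain ⟨σ, hσ⟩ := (Normal.minpoly_eq_iff_mem_orbit L).1 (Finset.mem_filter.1 hy).2
    exact ⟨σ, Finset.mem_univ _, hσ⟩
  · intro σ _
    rw [← aeval_algHom_apply]

open scoped Classical in
theorem aeval_twistedProd_eq_prod_nthRoots (hζ : IsPrimitiveRoot ζ n) (ha : a ≠ 0)
    {x : L} (hx : x ^ n = algebraMap K L a) (f : K[X]) :
    aeval x (twistedProd ζ f n) =
      ∏ y ∈ (nthRoots n (algebraMap K L a)).toFinset, aeval y f := by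
  have hζL : IsPrimitiveRoot (algebraMap K L ζ) n :=
    hζ.map_of_injective (algebraMap K L).injective
  have hnodup := hζL.nthRoots_nodup (a := algebraMap K L a) (by simpa using ha)
  rw [Finset.prod, Multiset.toFinset_val, hnodup.dedup, hζL.nthRoots_eq hx, Multiset.map_map,
    twistedProd, map_prod, Finset.prod, Finset.range_val]
  congr 1
  refine Multiset.map_congr rfl fun i _ => ?_
  simp [aeval_comp]

theorem exists_norm_eq_iff_exists_dvd_twistedProd_sub [FiniteDimensional K L] (hn : 0 < n)
    (hζ : IsPrimitiveRoot ζ n) (ha : a ≠ 0) (hα : α ^ n = algebraMap K L a)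
    (hgen : IntermediateField.adjoin K {α} = ⊤) (b : K) :
    (∃ c : L, Algebra.norm K c = b) ↔ ∃ f : K[X], X ^ n - C a ∣ twistedProd ζ f n - C b := by
  classical
  have := isGalois_of_adjoin_nthRoot hn hζ ha hα hgen
  have : NeZero n := ⟨hn.ne'⟩
  have hn' : (n : K) ≠ 0 := hζ.neZero'.out
  have hsep : (X ^ n - C a).Separable := separable_X_pow_sub_C a hn' ha
  set R := (nthRoots n (algebraMap K L a)).toFinset with hR
  have hmem : ∀ {x : L}, x ∈ R ↔ x ^ n = algebraMap K L a := by
    simp [hR, mem_nthRoots hn]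
  constructor
  · rintro ⟨c, hc⟩
    obtain ⟨g, rfl⟩ : ∃ g : K[X], aeval α g = c := by
      have : c ∈ IntermediateField.adjoin K {α} := hgen ▸ IntermediateField.mem_top
      rw [← IntermediateField.mem_toSubalgebra,
        IntermediateField.adjoin_simple_toSubalgebra_of_isAlgebraic (IsAlgebraic.of_finite K α),
        Algebra.adjoin_singleton_eq_range_aeval] at this
      exact this
    obtain ⟨q, hq⟩ : minpoly K α ∣ X ^ n - C a := minpoly.dvd _ _ (by simp [hα])
    obtain ⟨s, t, hst⟩ : IsCoprime (minpoly K α) q := (hq ▸ hsep).isCoprime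
    let f : K[X] := g * (t * q) + s * minpoly K α
    have hf₁ : ∀ x ∈ R, minpoly K x = minpoly K α → aeval x f = aeval x g := by
      intro x _ h
      have h0 : aeval x (minpoly K α) = 0 := h ▸ minpoly.aeval K x
      have h1 := congrArg (aeval x) hst
      simp only [map_add, map_mul, h0, mul_zero, zero_add, map_one] at h1
      simp [f, h0, h1]
    have hf₂ : ∀ x ∈ R, minpoly K x ≠ minpoly K α → aeval x f = 1 := by
      intro x hx h
      have h0 : aeval x (minpoly K α) * aeval x q = 0 := by
        rw [← map_mul, ← hq]
        simp [hmem.1 hx]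
      have h0' : aeval x (minpoly K α) ≠ 0 := fun h' => h <|
        (minpoly.eq_of_irreducible_of_monic (minpoly.irreducible (IsIntegral.of_finite K α)) h'
          (minpoly.monic (IsIntegral.of_finite K α))).symm
      have h2 := (mul_eq_zero.1 h0).resolve_left h0'
      have h1 := congrArg (aeval x) hst
      simp only [map_add, map_mul, h2, mul_zero, add_zero, map_one] at h1
      simp [f, h2, h1]
    have hprod : ∏ y ∈ R, aeval y f = algebraMap K L b := by
      rw [← hc, algebraMap_norm_aeval_eq_prod_conjugates hgen hn hα g,
        ← Finset.prod_filter_mul_prod_filter_not R (fun y => minpoly K y = minpoly K α),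
        Finset.prod_congr rfl (g := fun y => aeval y g)
          fun y hy => hf₁ y (Finset.mem_filter.1 hy).1 (Finset.mem_filter.1 hy).2,
        Finset.prod_eq_one
          fun y hy => hf₂ y (Finset.mem_filter.1 hy).1 (Finset.mem_filter.1 hy).2, mul_one]
    refine ⟨f, ?_⟩
    have hζL : IsPrimitiveRoot (algebraMap K L ζ) n :=
      hζ.map_of_injective (algebraMap K L).injective
    rw [← Polynomial.map_dvd_map' (algebraMap K L)]
    have hL : (X ^ n - C a).map (algebraMap K L) = X ^ n - C (algebraMap K L a) := by simp
    rw [hL, X_pow_sub_C_eq_prod hζL hn hα]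
    refine Finset.prod_dvd_of_coprime ?_ ?_
    · refine fun i hi j hj hij => ?_
      refine isCoprime_X_sub_C_of_isUnit_sub (sub_ne_zero.2 fun h => hij ?_).isUnit
      refine hζL.injOn_pow_mul (α := α) ?_ hi hj h
      rintro rfl
      rw [zero_pow hn.ne', eq_comm, map_eq_zero] at hα
      exact ha hα
    · intro i _
      rw [dvd_iff_isRoot, IsRoot.def, eval_map_algebraMap, map_sub,
        aeval_twistedProd_eq_prod_nthRoots hζ ha (x := algebraMap K L ζ ^ i * α), hprod,
        aeval_C, sub_self]
      rw [mul_pow, ← pow_mul, mul_comm i, pow_mul, hζL.pow_eq_one, one_pow, one_mul, hα]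
  · rintro ⟨f, g, hfg⟩
    have h1 : ∏ y ∈ R, aeval y f = algebraMap K L b := by
      rw [← aeval_twistedProd_eq_prod_nthRoots hζ ha hα]
      have := congrArg (aeval α) hfg
      simpa [hα, sub_eq_zero] using this
    rw [← Finset.prod_fiberwise_of_maps_to (t := R.image (minpoly K)) (g := minpoly K)
      fun x hx => Finset.mem_image_of_mem _ hx] at h1
    have h2 : ∀ p ∈ R.image (minpoly K), ∃ c : L,
        algebraMap K L (Algebra.norm K c) = ∏ y ∈ R with minpoly K y = p, aeval y f := by
      intro p hp
      obtain ⟨x, hx, rfl⟩ := Finset.mem_image.1 hp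
      exact ⟨_, algebraMap_norm_aeval_eq_prod_conjugates
        (adjoin_nthRoot_eq_top hn hζ hα hgen (hmem.1 hx)) hn (hmem.1 hx) f⟩
    choose! c hc using h2
    refine ⟨∏ p ∈ R.image (minpoly K), c p, (algebraMap K L).injective ?_⟩
    rw [← h1, map_prod, map_prod]
    exact Finset.prod_congr rfl hc

end Field

theorem eq_zero_of_sum_eigenvectors_eq_zero {K M ι : Type*} [Field K] [AddCommGroup M]
    [Module K M] [Fintype ι] (T : Module.End K M) {μ : ι → K} (hμ : Function.Injective μ)
    {x : ι → M} (hx : ∀ i, T (x i) = μ i • x i) (h0 : ∑ i, x i = 0) (i : ι) : x i = 0 :=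
  (iSupIndep_iff_finsetSum_eq_zero_imp_eq_zero _).1 (T.eigenspaces_iSupIndep.comp hμ) Finset.univ x
    (fun i _ => Module.End.mem_eigenspace_iff.2 (hx i)) h0 i (Finset.mem_univ _)

section Relations

variable {K B : Type*} [Field K] [Ring B] [Algebra K B] {n : ℕ} {ε a b : K} {U V : B}

theorem mul_pow_of_mul_eq_smul_mul (h : U * V = ε • (V * U)) (i : ℕ) :
    U * V ^ i = ε ^ i • (V ^ i * U) := by
  induction i with
  | zero => simp
  | succ i ih =>
    rw [pow_succ, ← mul_assoc, ih, smul_mul_assoc, mul_assoc, h, mul_smul_comm, smul_smul,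
      ← pow_succ, mul_assoc]

theorem pow_mul_of_mul_eq_smul_mul (h : U * V = ε • (V * U)) (j : ℕ) :
    U ^ j * V = ε ^ j • (V * U ^ j) := by
  induction j with
  | zero => simp
  | succ j ih =>
    rw [pow_succ', mul_assoc, ih, mul_smul_comm, ← mul_assoc, h, smul_mul_assoc, smul_smul,
      ← pow_succ, mul_assoc]

theorem linearIndependent_pow_mul_pow [Nontrivial B] (hn : 0 < n) (hε : IsPrimitiveRoot ε n)
    (ha : a ≠ 0) (hb : b ≠ 0) (hU : U ^ n = algebraMap K B a) (hV : V ^ n = algebraMap K B b)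
    (hUV : U * V = ε • (V * U)) :
    LinearIndependent K fun p : Fin n × Fin n => V ^ (p.1 : ℕ) * U ^ (p.2 : ℕ) := by
  have hinj : ∀ c : K, c ≠ 0 → Function.Injective fun i : Fin n => c * ε ^ (i : ℕ) :=
    fun c hc i j h => Fin.ext (hε.pow_inj i.2 j.2 (mul_left_cancel₀ hc h))
  have hunit : ∀ {W : B} {c : K}, c ≠ 0 → W ^ n = algebraMap K B c → IsUnit W := fun hc hW =>
    (isUnit_pow_iff hn.ne').1 (hW ▸ (IsUnit.mk0 _ hc).map (algebraMap K B))
  have hn1 : n - 1 + 1 = n := Nat.sub_add_cancel hn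
  rw [Fintype.linearIndependent_iff]
  intro g hg
  rw [Fintype.sum_prod_type_right] at hg
  have hcol : ∀ j : Fin n, ∑ i : Fin n, g (i, j) • (V ^ (i : ℕ) * U ^ (j : ℕ)) = 0 := by
    refine eq_zero_of_sum_eigenvectors_eq_zero
      (LinearMap.mulLeft K (V ^ (n - 1)) ∘ₗ LinearMap.mulRight K V) (hinj b hb) (fun j => ?_) hg
    rw [map_sum, Finset.smul_sum]
    refine Finset.sum_congr rfl fun i _ => ?_
    rw [map_smul, smul_comm]
    congr 1
    simp only [LinearMap.comp_apply, LinearMap.mulLeft_apply, LinearMap.mulRight_apply]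
    rw [mul_assoc (V ^ (i : ℕ)), pow_mul_of_mul_eq_smul_mul hUV, mul_smul_comm, mul_smul_comm,
      ← mul_assoc (V ^ (i : ℕ)), ← pow_succ, ← mul_assoc, ← pow_add,
      show n - 1 + ((i : ℕ) + 1) = n + i by omega, pow_add, hV, mul_assoc,
      ← Algebra.smul_def, smul_smul, mul_comm]
  rintro ⟨i, j⟩
  have h := eq_zero_of_sum_eigenvectors_eq_zero
    (LinearMap.mulRight K (U ^ (n - 1)) ∘ₗ LinearMap.mulLeft K U) (hinj a ha)
    (x := fun i => g (i, j) • (V ^ (i : ℕ) * U ^ (j : ℕ))) (fun i => ?_) (hcol j) i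
  · exact (smul_eq_zero.1 h).resolve_right
      (((hunit hb hV).pow _).mul ((hunit ha hU).pow _)).ne_zero
  · rw [map_smul, smul_comm]
    congr 1
    simp only [LinearMap.comp_apply, LinearMap.mulLeft_apply, LinearMap.mulRight_apply]
    rw [← mul_assoc, mul_pow_of_mul_eq_smul_mul hUV, smul_mul_assoc, smul_mul_assoc, mul_assoc,
      mul_assoc, ← pow_add, ← pow_succ', show (j : ℕ) + (n - 1) + 1 = j + n by omega, pow_add, hU,
      ← Algebra.commutes, ← Algebra.smul_def, mul_smul_comm, smul_smul, mul_comm]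

theorem mul_aeval_of_mul_eq_smul_mul (hε : ε ≠ 0) (h : U * V = ε • (V * U)) (f : K[X]) :
    V * aeval U f = aeval U (f.comp (C ε⁻¹ * X)) * V := by
  induction f using Polynomial.induction_on' with
  | add p q hp hq => simp only [map_add, mul_add, add_comp, add_mul, hp, hq]
  | monomial j c =>
    rw [← C_mul_X_pow_eq_monomial]
    simp only [mul_comp, C_comp, pow_comp, X_comp, map_mul, map_pow, aeval_C, aeval_X, mul_pow,
      mul_assoc]
    rw [pow_mul_of_mul_eq_smul_mul h, ← mul_assoc, ← Algebra.commutes, mul_assoc, ← map_pow,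
      ← Algebra.smul_def (ε⁻¹ ^ j), smul_smul, ← mul_pow, inv_mul_cancel₀ hε, one_pow, one_smul]

end Relations

theorem AlgHom.bijective_of_linearIndependent_comp {K A B ι : Type*} [Field K] [Ring A] [Algebra K A]
    [Ring B] [Algebra K B] [Fintype ι] [Nonempty ι] (φ : A →ₐ[K] B) {x : ι → A}
    (hx : Submodule.span K (Set.range x) = ⊤) (hli : LinearIndependent K (φ.toLinearMap ∘ x))
    (hcard : Fintype.card ι = Module.finrank K B) : Function.Bijective φ := by
  have htop := hli.span_eq_top_of_card_eq_finrank hcard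
  let e := Module.Basis.mk (LinearIndependent.of_comp _ hli) hx.ge
  have : Module.Finite K A := Module.Finite.of_basis e
  have : FiniteDimensional K B := Module.finite_of_finrank_pos (hcard ▸ Fintype.card_pos)
  have hsurj : Function.Surjective φ.toLinearMap := by
    rw [← LinearMap.range_eq_top, eq_top_iff, ← htop, Submodule.span_le]
    rintro _ ⟨i, rfl⟩
    exact ⟨_, rfl⟩
  have hfin : Module.finrank K A = Module.finrank K B := by
    rw [Module.finrank_eq_card_basis e, hcard]
  exact ⟨(LinearMap.injective_iff_surjective_of_finrank_eq_finrank hfin).2 hsurj, hsurj⟩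

theorem twistedProd_succ {K : Type*} [Field K] (ζ : K) (f : K[X]) (k : ℕ) :
    twistedProd ζ f (k + 1) = (twistedProd ζ f k).comp (C ζ * X) * f := by
  rw [twistedProd, twistedProd, Finset.prod_range_succ', prod_comp]
  simp [comp_assoc, pow_succ, mul_assoc]

section End

variable {K W : Type*} [Field K] [AddCommGroup W] [Module K W] {n : ℕ} {ε a b : K}
  {U V : Module.End K W}

theorem exists_aeval_apply_surjective [FiniteDimensional K W]
    (h : (minpoly K U).natDegree = Module.finrank K W) :
    ∃ w : W, Function.Surjective fun f : K[X] => aeval U f w := by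
  obtain ⟨x, hx⟩ := Module.exists_ker_toSpanSingleton_eq_annihilator K[X] (Module.AEval' U)
  obtain ⟨w, rfl⟩ := (Module.AEval'.of U).surjective x
  rw [← span_minpoly_eq_annihilator] at hx
  have hker : ∀ f : K[X], aeval U f w = 0 → minpoly K U ∣ f := by
    intro f hf
    rw [← Ideal.mem_span_singleton, ← hx, LinearMap.mem_ker, LinearMap.toSpanSingleton_apply]
    change f • Module.AEval.of K W U w = 0
    rw [← Module.AEval.of_aeval_smul, Module.End.smul_def, hf, map_zero]
  refine ⟨w, ?_⟩
  have hint : IsIntegral K U := Algebra.IsIntegral.isIntegral U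
  let φ : K[X] →ₗ[K] W := LinearMap.applyₗ w ∘ₗ (aeval U : K[X] →ₐ[K] Module.End K W).toLinearMap
  let ψ : degreeLT K (minpoly K U).natDegree →ₗ[K] W := φ ∘ₗ Submodule.subtype _
  have hψ : Function.Injective ψ := by
    rw [← LinearMap.ker_eq_bot, LinearMap.ker_eq_bot']
    rintro ⟨f, hf⟩ h0
    refine Subtype.ext (eq_zero_of_dvd_of_degree_lt (hker f h0) ?_)
    rw [degree_eq_natDegree (minpoly.ne_zero hint)]
    exact mem_degreeLT.1 hf
  have hfin : Module.finrank K (degreeLT K (minpoly K U).natDegree) = Module.finrank K W := by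
    rw [← h, (degreeLTEquiv K _).finrank_eq, Module.finrank_fin_fun]
  have : FiniteDimensional K (degreeLT K (minpoly K U).natDegree) :=
    Module.Finite.equiv (degreeLTEquiv K _).symm
  intro y
  obtain ⟨f, hf⟩ := (LinearMap.injective_iff_surjective_of_finrank_eq_finrank hfin).1 hψ y
  exact ⟨f, hf⟩

theorem minpoly_eq_X_pow_sub_C [Nontrivial W] [FiniteDimensional K W] (hn : 0 < n)
    (hε : IsPrimitiveRoot ε n) (ha : a ≠ 0) (hb : b ≠ 0) (hU : U ^ n = algebraMap K _ a)
    (hV : V ^ n = algebraMap K _ b) (hUV : U * V = ε • (V * U)) :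
    minpoly K U = X ^ n - C a := by
  refine (minpoly.unique' _ _ (monic_X_pow_sub_C a hn.ne') (by simp [hU]) fun q hq => ?_).symm
  by_contra! hcon
  obtain ⟨hq0, hq1⟩ := hcon
  have hdeg : q.natDegree < n := by
    rw [degree_X_pow_sub_C hn] at hq
    exact (natDegree_lt_iff_degree_lt hq0).2 hq
  have hli := (linearIndependent_pow_mul_pow hn hε ha hb hU hV hUV).comp
    (fun j : Fin n => ((⟨0, hn⟩, j) : Fin n × Fin n)) fun i j h => by simpa using h
  rw [Fintype.linearIndependent_iff] at hli
  rw [aeval_eq_sum_range' hdeg, Finset.sum_range] at hq1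
  refine hq0 (Polynomial.ext fun j => ?_)
  by_cases hj : j < n
  · simpa using hli (fun j => q.coeff j) (by simpa using hq1) ⟨j, hj⟩
  · exact coeff_eq_zero_of_natDegree_lt (by omega)

theorem exists_dvd_twistedProd_sub_of_end [Nontrivial W] [FiniteDimensional K W]
    (hn : 0 < n) (hW : Module.finrank K W = n)
    (hε : IsPrimitiveRoot ε n) (ha : a ≠ 0) (hb : b ≠ 0) (hU : U ^ n = algebraMap K _ a)
    (hV : V ^ n = algebraMap K _ b) (hUV : U * V = ε • (V * U)) :
    ∃ f : K[X], X ^ n - C a ∣ twistedProd ε⁻¹ f n - C b := by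
  have hmin := minpoly_eq_X_pow_sub_C hn hε ha hb hU hV hUV
  obtain ⟨w, hw⟩ := exists_aeval_apply_surjective (U := U)
    (by rw [hmin, hW, natDegree_X_pow_sub_C])
  obtain ⟨f, hf⟩ := hw (V w)
  have hpow : ∀ k, (V ^ k) w = aeval U (twistedProd ε⁻¹ f k) w := by
    intro k
    induction k with
    | zero => simp [twistedProd]
    | succ k ih =>
      rw [pow_succ', Module.End.mul_apply, ih, ← Module.End.mul_apply,
        mul_aeval_of_mul_eq_smul_mul (hε.ne_zero hn.ne') hUV, Module.End.mul_apply, ← hf,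
        twistedProd_succ, map_mul, Module.End.mul_apply]
  refine ⟨f, ?_⟩
  rw [← hmin]
  refine minpoly.dvd _ _ (LinearMap.ext fun y => ?_)
  obtain ⟨g, rfl⟩ := hw y
  have h0 : aeval U (twistedProd ε⁻¹ f n - C b) w = 0 := by
    rw [map_sub, LinearMap.sub_apply, ← hpow, hV, aeval_C, sub_self]
  change aeval U _ (aeval U g w) = 0
  rw [← Module.End.mul_apply, ← map_mul, mul_comm, map_mul, Module.End.mul_apply, h0, map_zero]

end End

section Symbol

variable {K : Type} [Field K] {n : ℕ} {ε a b : K}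

namespace SymbolAlgebra

/-- The quotient map from the free algebra on two generators. -/
noncomputable def mk (n : ℕ) (ε a b : K) : FreeAlgebra K (Fin 2) →ₐ[K] SymbolAlgebra K n ε a b :=
  RingQuot.mkAlgHom K (SymbolRel K n ε a b)

theorem mk_surjective : Function.Surjective (mk n ε a b) :=
  RingQuot.mkAlgHom_surjective K _

theorem mk_eq_of_rel {p q : FreeAlgebra K (Fin 2)} (h : SymbolRel K n ε a b p q) :
    mk n ε a b p = mk n ε a b q :=
  RingQuot.mkAlgHom_rel K h

/-- The generator `u`. -/
noncomputable def u (n : ℕ) (ε a b : K) : SymbolAlgebra K n ε a b := mk n ε a b (FreeAlgebra.ι K 0)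

/-- The generator `v`. -/
noncomputable def v (n : ℕ) (ε a b : K) : SymbolAlgebra K n ε a b := mk n ε a b (FreeAlgebra.ι K 1)

theorem u_pow : u n ε a b ^ n = algebraMap K _ a := by
  simpa [u] using mk_eq_of_rel (n := n) (ε := ε) (a := a) (b := b) (.inl ⟨rfl, rfl⟩)

theorem v_pow : v n ε a b ^ n = algebraMap K _ b := by
  simpa [v] using mk_eq_of_rel (n := n) (ε := ε) (a := a) (b := b) (.inr (.inl ⟨rfl, rfl⟩))

theorem u_mul_v : u n ε a b * v n ε a b = ε • (v n ε a b * u n ε a b) := by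
  simpa [u, v, Algebra.smul_def] using
    mk_eq_of_rel (n := n) (ε := ε) (a := a) (b := b) (.inr (.inr ⟨rfl, rfl⟩))

theorem nonempty_algHom {B : Type*} [Ring B] [Algebra K B] {U V : B}
    (hU : U ^ n = algebraMap K B a) (hV : V ^ n = algebraMap K B b) (hUV : U * V = ε • (V * U)) :
    Nonempty (SymbolAlgebra K n ε a b →ₐ[K] B) := by
  let F : FreeAlgebra K (Fin 2) →ₐ[K] B := FreeAlgebra.lift K ![U, V]
  have hF : ∀ ⦃p q⦄, SymbolRel K n ε a b p q → F p = F q := by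
    rintro p q (⟨rfl, rfl⟩ | ⟨rfl, rfl⟩ | ⟨rfl, rfl⟩)
    · simp [F, hU]
    · simp [F, hV]
    · simp [F, hUV, Algebra.smul_def]
  exact ⟨RingQuot.liftAlgHom K ⟨F, hF⟩⟩

theorem span_pow_mul_pow (hn : 0 < n) :
    Submodule.span K (Set.range fun p : Fin n × Fin n =>
      v n ε a b ^ (p.1 : ℕ) * u n ε a b ^ (p.2 : ℕ)) = ⊤ := by
  set S := Submodule.span K (Set.range fun p : Fin n × Fin n =>
      v n ε a b ^ (p.1 : ℕ) * u n ε a b ^ (p.2 : ℕ)) with hS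
  have hmem : ∀ i j : ℕ, v n ε a b ^ i * u n ε a b ^ j ∈ S := by
    intro i j
    have hi : v n ε a b ^ i = b ^ (i / n) • v n ε a b ^ (i % n) := by
      conv_lhs => rw [← Nat.div_add_mod i n, pow_add, pow_mul, v_pow, ← map_pow,
        ← Algebra.smul_def]
    have hj : u n ε a b ^ j = a ^ (j / n) • u n ε a b ^ (j % n) := by
      conv_lhs => rw [← Nat.div_add_mod j n, pow_add, pow_mul, u_pow, ← map_pow,
        ← Algebra.smul_def]
    rw [hi, hj, smul_mul_assoc, mul_smul_comm]
    exact S.smul_mem _ (S.smul_mem _ (Submodule.subset_span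
      ⟨(⟨i % n, Nat.mod_lt i hn⟩, ⟨j % n, Nat.mod_lt j hn⟩), rfl⟩))
  have hleft : ∀ y : SymbolAlgebra K n ε a b, (∀ i j : ℕ, y * (v n ε a b ^ i * u n ε a b ^ j) ∈ S) →
      ∀ s ∈ S, y * s ∈ S := by
    intro y hy s hs
    induction hs using Submodule.span_induction with
    | mem x hx => obtain ⟨p, rfl⟩ := hx; exact hy _ _
    | zero => simp
    | add x z _ _ hx hz => rw [mul_add]; exact S.add_mem hx hz
    | smul c x _ hx => rw [mul_smul_comm]; exact S.smul_mem _ hx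
  have hact : ∀ x : FreeAlgebra K (Fin 2), ∀ s ∈ S, mk n ε a b x * s ∈ S := by
    intro x
    induction x using FreeAlgebra.induction with
    | grade0 r =>
      intro s hs
      rw [AlgHom.commutes, ← Algebra.smul_def]
      exact S.smul_mem _ hs
    | grade1 k =>
      refine hleft _ fun i j => ?_
      fin_cases k
      · change u n ε a b * _ ∈ S
        rw [← mul_assoc, mul_pow_of_mul_eq_smul_mul u_mul_v, smul_mul_assoc, mul_assoc, ← pow_succ']
        exact S.smul_mem _ (hmem _ _)
      · change v n ε a b * _ ∈ S
        rw [← mul_assoc, ← pow_succ']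
        exact hmem _ _
    | mul x y hx hy => intro s hs; rw [map_mul, mul_assoc]; exact hx _ (hy _ hs)
    | add x y hx hy => intro s hs; rw [map_add, add_mul]; exact S.add_mem (hx _ hs) (hy _ hs)
  refine eq_top_iff.2 fun y _ => ?_
  obtain ⟨x, rfl⟩ := mk_surjective y
  simpa using hact x 1 (by simpa using hmem 0 0)

theorem bijective_algHom {B : Type*} [Ring B] [Algebra K B] [Nontrivial B] (hn : 0 < n)
    (hB : Module.finrank K B = n * n) (hε : IsPrimitiveRoot ε n) (ha : a ≠ 0) (hb : b ≠ 0)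
    (φ : SymbolAlgebra K n ε a b →ₐ[K] B) : Function.Bijective φ := by
  have hli := linearIndependent_pow_mul_pow hn hε ha hb (U := φ (u n ε a b)) (V := φ (v n ε a b))
    (by rw [← map_pow, u_pow, AlgHom.commutes]) (by rw [← map_pow, v_pow, AlgHom.commutes])
    (by rw [← map_mul, u_mul_v, map_smul, map_mul])
  have hcomp : (fun p : Fin n × Fin n => φ (v n ε a b) ^ (p.1 : ℕ) * φ (u n ε a b) ^ (p.2 : ℕ)) =
      φ.toLinearMap ∘ fun p : Fin n × Fin n => v n ε a b ^ (p.1 : ℕ) * u n ε a b ^ (p.2 : ℕ) := by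
    ext p; simp
  rw [hcomp] at hli
  have : Nonempty (Fin n × Fin n) := ⟨(⟨0, hn⟩, ⟨0, hn⟩)⟩
  exact φ.bijective_of_linearIndependent_comp (span_pow_mul_pow hn) hli (by simp [hB])

end SymbolAlgebra

theorem exists_end_of_dvd_twistedProd_sub (hn : 0 < n) (hε : ε ^ n = 1) {f : K[X]}
    (hf : X ^ n - C a ∣ twistedProd ε⁻¹ f n - C b) :
    ∃ U V : Module.End K (AdjoinRoot (X ^ n - C a)), U ^ n = algebraMap K _ a ∧
      V ^ n = algebraMap K _ b ∧ U * V = ε • (V * U) := by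
  have hε0 : ε ≠ 0 := by rintro rfl; simp [zero_pow hn.ne'] at hε
  let r : AdjoinRoot (X ^ n - C a) := AdjoinRoot.root (X ^ n - C a)
  have hr : r ^ n = algebraMap K _ a := by
    have := AdjoinRoot.eval₂_root (X ^ n - C a)
    simpa [sub_eq_zero] using this
  let σ : AdjoinRoot (X ^ n - C a) →ₐ[K] AdjoinRoot (X ^ n - C a) :=
    AdjoinRoot.liftAlgHom _ (Algebra.ofId K _) (ε⁻¹ • r) (by
      have : (ε⁻¹ • r) ^ n = algebraMap K _ a := by
        rw [_root_.smul_pow, inv_pow, hε, inv_one, one_smul, hr]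
      simp [eval₂_sub, this])
  have hσr : σ r = ε⁻¹ • r := AdjoinRoot.liftAlgHom_root _ _ _ _
  have hσ : ∀ g : K[X], σ (aeval r g) = aeval r (g.comp (C ε⁻¹ * X)) := by
    intro g
    rw [← aeval_algHom_apply, hσr, aeval_comp]
    simp [Algebra.smul_def]
  let U := LinearMap.mulLeft K r
  let V := LinearMap.mulLeft K (aeval r f) ∘ₗ σ.toLinearMap
  have hV : ∀ k x, (V ^ k) x = aeval r (twistedProd ε⁻¹ f k) * (σ ^ k) x := by
    intro k
    induction k with
    | zero => simp [twistedProd]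
    | succ k ih =>
      intro x
      rw [pow_succ', Module.End.mul_apply, ih, twistedProd_succ, pow_succ', AlgHom.mul_apply]
      simp only [V, LinearMap.comp_apply, LinearMap.mulLeft_apply, AlgHom.toLinearMap_apply,
        map_mul, hσ]
      ring
  have hσk : ∀ k, (σ ^ k) r = (ε⁻¹ ^ k) • r := by
    intro k
    induction k with
    | zero => simp
    | succ k ih => rw [pow_succ', AlgHom.mul_apply, ih, map_smul, hσr, smul_smul, ← pow_succ]
  have hσn : σ ^ n = 1 := by
    refine AdjoinRoot.algHom_ext ?_
    change (σ ^ n) r = r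
    rw [hσk, inv_pow, hε, inv_one, one_smul]
  refine ⟨U, V, ?_, ?_, ?_⟩
  · refine LinearMap.ext fun x => ?_
    rw [LinearMap.pow_mulLeft, hr, LinearMap.mulLeft_apply, Module.algebraMap_end_apply,
      Algebra.smul_def]
  · refine LinearMap.ext fun x => ?_
    have h0 : aeval r (twistedProd ε⁻¹ f n) = algebraMap K _ b := by
      obtain ⟨g, hg⟩ := hf
      have := congrArg (aeval r) hg
      simpa [hr, sub_eq_zero] using this
    rw [hV, hσn, h0, Module.algebraMap_end_apply, Algebra.smul_def]
    rfl
  · refine LinearMap.ext fun x => ?_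
    simp only [U, V, Module.End.mul_apply, LinearMap.smul_apply, LinearMap.comp_apply,
      LinearMap.mulLeft_apply, AlgHom.toLinearMap_apply, map_mul, hσr, smul_mul_assoc,
      mul_smul_comm, smul_smul, mul_inv_cancel₀ hε0, one_smul]
    ring

theorem SymbolAlgebra.nonempty_algEquiv_matrix_iff (hn : 0 < n) (hε : IsPrimitiveRoot ε n)
    (ha : a ≠ 0) (hb : b ≠ 0) :
    Nonempty (SymbolAlgebra K n ε a b ≃ₐ[K] Matrix (Fin n) (Fin n) K) ↔
      ∃ f : K[X], X ^ n - C a ∣ twistedProd ε⁻¹ f n - C b := by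
  constructor
  · rintro ⟨e⟩
    have : Nonempty (Fin n) := ⟨⟨0, hn⟩⟩
    let φ : SymbolAlgebra K n ε a b →ₐ[K] Module.End K (Fin n → K) :=
      (e.trans Matrix.toLinAlgEquiv' : _ ≃ₐ[K] Module.End K (Fin n → K))
    exact exists_dvd_twistedProd_sub_of_end (U := φ (u n ε a b)) (V := φ (v n ε a b)) hn (by simp)
      hε ha hb (by rw [← map_pow, u_pow, AlgHom.commutes]) (by rw [← map_pow, v_pow, AlgHom.commutes])
      (by rw [← map_mul, u_mul_v, map_smul, map_mul])
  · rintro ⟨f, hf⟩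
    obtain ⟨U, V, hU, hV, hUV⟩ := exists_end_of_dvd_twistedProd_sub hn hε.pow_eq_one hf
    obtain ⟨φ⟩ := nonempty_algHom hU hV hUV
    let pb := AdjoinRoot.powerBasis (X_pow_sub_C_ne_zero hn a)
    have hdim : pb.dim = n := by
      rw [AdjoinRoot.powerBasis_dim, natDegree_X_pow_sub_C]
    let e := algEquivMatrix (pb.basis.reindex (finCongr hdim))
    have : Nonempty (Fin n) := ⟨⟨0, hn⟩⟩
    exact ⟨AlgEquiv.ofBijective (e.toAlgHom.comp φ)
      (bijective_algHom hn (by simp [Module.finrank_matrix]) hε ha hb _)⟩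

end Symbol

end

/-- the symbol algebra `(a,b;K,ε)` is split (isomorphic to `Mₙ(K)`) if and only if
`b` is a norm from the extension `K(a^{1/n})/K`; here `L = K(α)` with `αⁿ = a`. -/
theorem stmt6 (K : Type) [Field K] (n : ℕ) (hn : 0 < n) (ε : K)
    (hε : IsPrimitiveRoot ε n) (a b : K) (ha : a ≠ 0) (hb : b ≠ 0)
    (L : Type) [Field L] [Algebra K L] [FiniteDimensional K L]
    (α : L) (hα : α ^ n = algebraMap K L a)
    (hgen : IntermediateField.adjoin K {α} = ⊤) :
    Nonempty (SymbolAlgebra K n ε a b ≃ₐ[K] Matrix (Fin n) (Fin n) K)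
      ↔ ∃ c : L, Algebra.norm K c = b := by
  rw [SymbolAlgebra.nonempty_algEquiv_matrix_iff hn hε ha hb,
    exists_norm_eq_iff_exists_dvd_twistedProd_sub hn hε.inv ha hα hgen b]
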